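/- Let k ≥ 1 and let d = (d_1,…,d_k) and e = (e_1,…,e_{k+1}) be non-decreasing sequences of positive integers satisfying conditions (C1), (C2), (C3). Then there exist homogeneous polynomials g_1,…,g_{k+1} and f_1,…,f_k in ℂ[x_0,…,x_{k+3}] with deg g_j = e_j for all j ≤ k+1 and deg f_i = d_i for all i ≤ k, such that: (a) each f_i lies in the ideal ⟨g_1,…,g_{k+1}⟩; (b) for every i ≤ k+1 the projective variety V(g_1,…,g_i) is smooth of dimension k+3−i (the Jacobian matrix of (g_1,…,g_i) has rank i at every nonzero point of the affine cone over V(g_1,…,g_i)); and (c) for every s ≤ k−1 the projective variety V(f_1,…,f_s) has dimension k+3−s and is smooth in codimension 3. -/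

import Mathlib

noncomputable section
open MvPolynomial

/-- The Jacobian matrix of the family `p 1, …, p m` of polynomials in the variables
`x_0, …, x_n`, evaluated at the point `x` of the affine cone `ℂ^{n+1}`. -/
def jacobianAt (n m : ℕ) (p : ℕ → MvPolynomial (Fin (n + 1)) ℂ) (x : Fin (n + 1) → ℂ) :
    Matrix (Fin m) (Fin (n + 1)) ℂ :=
  Matrix.of fun l j => eval x (pderiv j (p (l.1 + 1)))

/-- `x` is a nonzero point of the affine cone over `V(p_1,…,p_m)` at which the
Jacobian matrix has rank `< m`; i.e. `x` represents a singular point of `V(p_1,…,p_m)`. -/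
def SingularConePt (n m : ℕ) (p : ℕ → MvPolynomial (Fin (n + 1)) ℂ)
    (x : Fin (n + 1) → ℂ) : Prop :=
  x ≠ 0 ∧ (∀ l, 1 ≤ l → l ≤ m → eval x (p l) = 0) ∧ (jacobianAt n m p x).rank < m

/-- The set of singular points of `V(p_1,…,p_m)` in projective space `P^n(ℂ)`. -/
def projSingularLocus (n m : ℕ) (p : ℕ → MvPolynomial (Fin (n + 1)) ℂ) :
    Set (Projectivization ℂ (Fin (n + 1) → ℂ)) :=
  {P | ∃ x, ∃ hx : x ≠ 0, SingularConePt n m p x ∧ P = Projectivization.mk ℂ x hx}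

/-- The ideal generated by `p_1,…,p_m` together with all `m × m` minors of the
Jacobian matrix; its projective zero locus is the singular locus of `V(p_1,…,p_m)`. -/
def singularIdeal (n m : ℕ) (p : ℕ → MvPolynomial (Fin (n + 1)) ℂ) :
    Ideal (MvPolynomial (Fin (n + 1)) ℂ) :=
  Ideal.span ((fun i => p i) '' Set.Icc 1 m ∪
    {q | ∃ c : Fin m → Fin (n + 1),
      q = (Matrix.of fun l l' : Fin m => pderiv (c l') (p (l.1 + 1))).det})

/-- `V(p_1,…,p_m) ⊂ P^n(ℂ)` is smooth in codimension 3: its singular locus, as a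
projective algebraic set, has dimension at most `dim V(p_1,…,p_m) − 4`.  This is
expressed via Krull dimensions of the homogeneous coordinate rings (the projective
dimension being the Krull dimension of the affine cone minus 1). -/
def SmoothInCodimThree (n m : ℕ) (p : ℕ → MvPolynomial (Fin (n + 1)) ℂ) : Prop :=
  ringKrullDim (MvPolynomial (Fin (n + 1)) ℂ ⧸ singularIdeal n m p) + 4 ≤
    ringKrullDim (MvPolynomial (Fin (n + 1)) ℂ ⧸
      Ideal.span ((fun i => p i) '' Set.Icc 1 m))

/-- `(d_1,…,d_len)` is obtained from `(e_1,…,e_{len+1})` by deleting one entry. -/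
def DelOne (d e : ℕ → ℕ) (len : ℕ) : Prop :=
  ∃ m, 1 ≤ m ∧ m ≤ len + 1 ∧ ∀ j, 1 ≤ j → j ≤ len → d j = if j < m then e j else e (j + 1)

/-- Condition (C1): `d_i ≥ e_i` for `1 ≤ i ≤ k`. -/
def CondOne (k : ℕ) (d e : ℕ → ℕ) : Prop := ∀ i, 1 ≤ i → i ≤ k → e i ≤ d i

/-- Condition (C2): for `1 ≤ i ≤ k`, if `d_i < e_{i+1}` then `(d_1,…,d_i) = (e_1,…,e_i)`. -/
def CondTwo (k : ℕ) (d e : ℕ → ℕ) : Prop :=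
  ∀ i, 1 ≤ i → i ≤ k → d i < e (i + 1) → ∀ j, 1 ≤ j → j ≤ i → d j = e j

/-- Condition (C3): for `1 ≤ i ≤ k−1`, if `d_i < e_{i+2}` then `(d_1,…,d_i)` is a
subsequence of `(e_1,…,e_{i+1})` (obtained by deleting one entry). -/
def CondThree (k : ℕ) (d e : ℕ → ℕ) : Prop :=
  ∀ i, 1 ≤ i → i ≤ k - 1 → d i < e (i + 2) → DelOne d e i

open scoped IntermediateField.algebraAdjoinAdjoin in
theorem formallySmooth_adjoin_of_algebraicIndependent {F L ι : Type*} [Field F] [CharZero F]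
    [Field L] [Algebra F L] (z : ι → L) :
    Algebra.FormallySmooth (Algebra.adjoin F (Set.range z)) L := by
  let E := IntermediateField.adjoin F (Set.range z)
  have h1 : Algebra.FormallySmooth (Algebra.adjoin F (Set.range z)) E :=
    .of_isLocalization (nonZeroDivisors _)
  obtain ⟨s, hs⟩ := exists_isTranscendenceBasis E L
  have halg : Algebra.IsAlgebraic (IntermediateField.adjoin E (Set.range ((↑) : s → L))) L :=
    hs.isAlgebraic_field
  have h2 : Algebra.FormallySmooth E L := .of_algebraicIndependent_of_isSeparable hs.1
  exact .comp _ E _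

theorem exists_derivation_of_algebraicIndependent {F L ι : Type*} [Field F] [CharZero F]
    [Field L] [Algebra F L] {z : ι → L} (hz : AlgebraicIndependent F z) (v : ι → L) :
    ∃ D : Derivation F L L, ∀ i, D (z i) = v i := by
  let S := Algebra.adjoin F (Set.range z)
  let ψ : S →ₐ[F] TrivSqZeroExt L L :=
    (aeval fun i => TrivSqZeroExt.inl (z i) + TrivSqZeroExt.inr (v i)).comp
      hz.aevalEquiv.symm.toAlgHom
  let _ : Algebra S (TrivSqZeroExt L L) := ψ.toRingHom.toAlgebra
  have hfst (s : S) : (ψ s).fst = (s : L) := by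
    have : (TrivSqZeroExt.fstHom F L L).comp ψ = S.val := by
      rw [← AlgHom.cancel_right (f := hz.aevalEquiv.toAlgHom) hz.aevalEquiv.surjective]
      ext i
      simp [ψ, S]
    exact DFunLike.congr_fun this s
  let π : TrivSqZeroExt L L →ₐ[S] L :=
    { (TrivSqZeroExt.fstHom L L L : TrivSqZeroExt L L →+* L) with commutes' := hfst }
  have hfs := formallySmooth_adjoin_of_algebraicIndependent (F := F) z
  have hπ : Function.Surjective π := fun a => ⟨TrivSqZeroExt.inl a, rfl⟩
  have hker : IsNilpotent (RingHom.ker π) := by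
    refine ⟨2, ?_⟩
    refine (pow_two (RingHom.ker π)).trans (eq_bot_iff.2 (Ideal.mul_le.2 ?_))
    intro a ha b hb
    have ha' : a.fst = 0 := ha
    have hb' : b.fst = 0 := hb
    rw [Ideal.mem_bot]
    ext <;> simp [ha', hb']
  let φ : L →ₐ[S] TrivSqZeroExt L L :=
    Algebra.FormallySmooth.liftOfSurjective (AlgHom.id S L) π hπ hker
  have hφ (a : L) : (φ a).fst = a :=
    Algebra.FormallySmooth.liftOfSurjective_apply (AlgHom.id S L) π hπ hker a
  have hφS (s : S) : φ (s : L) = ψ s := φ.commutes s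
  have hφF (c : F) : φ (algebraMap F L c) = algebraMap F _ c := by
    have := hφS (algebraMap F S c)
    rw [AlgHom.commutes] at this
    exact this
  refine ⟨Derivation.mk'
    { toFun := fun a => (φ a).snd
      map_add' := by simp
      map_smul' := fun c a => by
        simp [Algebra.smul_def, hφF, TrivSqZeroExt.algebraMap_eq_inl'] }
    fun a b => by simp [hφ, mul_comm], fun i => ?_⟩
  have hzi : z i = (hz.aevalEquiv (X i) : S) := by simp
  have hφi : φ (z i) = TrivSqZeroExt.inl (z i) + TrivSqZeroExt.inr (v i) := by
    conv_lhs => rw [hzi, hφS]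
    simp [ψ, -DualNumber.inr_eq_smul_eps]
  simp [hφi]

theorem exists_algebraicIndependent_complex : ∃ c : ℕ × ℕ × ℕ → ℂ, AlgebraicIndependent ℚ c := by
  obtain ⟨s, hs⟩ := exists_isTranscendenceBasis ℚ ℂ
  have h := IsAlgClosed.cardinal_eq_cardinal_transcendence_basis_of_aleph0_lt' _ hs
    (by simp) (by simp [Cardinal.aleph0_lt_continuum])
  have : Infinite s := by
    rw [Cardinal.infinite_iff, ← h]; simp [Cardinal.aleph0_le_continuum]
  obtain ⟨e⟩ : Nonempty (ℕ × ℕ × ℕ ↪ s) :=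
    ⟨(Denumerable.eqv (ℕ × ℕ × ℕ)).toEmbedding.trans (Infinite.natEmbedding s)⟩
  exact ⟨_, hs.1.comp e e.injective⟩

theorem ringKrullDim_quotient_le_of_isPrime {R : Type*} [CommRing R] (I : Ideal R) (d : WithBot ℕ∞)
    (h : ∀ P : Ideal R, P.IsPrime → I ≤ P → ringKrullDim (R ⧸ P) ≤ d) :
    ringKrullDim (R ⧸ I) ≤ d := by
  rw [ringKrullDim_quotient]
  refine iSup_le fun p => ?_
  let P := p.head
  refine le_trans ?_ (h P.1.asIdeal P.1.2 P.2)
  rw [ringKrullDim_quotient]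
  let q : LTSeries (PrimeSpectrum.zeroLocus (R := R) P.1.asIdeal) :=
    ⟨p.length, fun i => ⟨(p i).1, (LTSeries.head_le p i)⟩, fun i => p.step i⟩
  exact le_iSup (fun q : LTSeries (PrimeSpectrum.zeroLocus (R := R) P.1.asIdeal) =>
    (q.length : WithBot ℕ∞)) q

theorem ringKrullDim_le_of_isIntegral {R S : Type*} [CommRing R] [CommRing S] [Algebra R S]
    [Algebra.IsIntegral R S] : ringKrullDim S ≤ ringKrullDim R :=
  Order.krullDim_le_of_strictMono (PrimeSpectrum.comap (algebraMap R S)) fun p q hpq => by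
    have := p.2
    exact Ideal.IsIntegral.comap_lt_comap (R := R) hpq

theorem exists_algebraicIndependent_ringKrullDim_le {K A : Type*} [Field K] [CommRing A]
    [IsDomain A] [Algebra K A] [Algebra.FiniteType K A] :
    ∃ (t : ℕ) (y : Fin t → A), AlgebraicIndependent K y ∧ ringKrullDim A ≤ t := by
  obtain ⟨t, g, hg, hint⟩ := exists_integral_inj_algHom_of_fg K A
  refine ⟨t, fun i => g (X i), ?_, ?_⟩
  · have : aeval (fun i => g (X i)) = g := by ext; simp
    rw [algebraicIndependent_iff_injective_aeval, this]
    exact hg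
  · let _ := g.toRingHom.toAlgebra
    have : Algebra.IsIntegral (MvPolynomial (Fin t) K) A := ⟨hint⟩
    refine (ringKrullDim_le_of_isIntegral (R := MvPolynomial (Fin t) K)).trans ?_
    simp

theorem card_add_card_le_finrank {K W E : Type*} [Field K] [AddCommGroup W] [Module K W]
    [FiniteDimensional K W] [Fintype E] {t : ℕ} (w : Fin t → W) (hw : LinearIndependent K w)
    (φ : E → Module.Dual K W) (hφ : LinearIndependent K φ) (h : ∀ e a, φ e (w a) = 0) :
    t + Fintype.card E ≤ Module.finrank K W := by
  have h1 := Subspace.finrank_add_finrank_dualCoannihilator_eq (Submodule.span K (Set.range φ))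
  have h2 : Submodule.span K (Set.range w) ≤
      (Submodule.span K (Set.range φ)).dualCoannihilator := by
    rw [Submodule.span_le]
    rintro _ ⟨a, rfl⟩
    rw [SetLike.mem_coe, Submodule.mem_dualCoannihilator]
    intro f hf
    induction hf using Submodule.span_induction with
    | mem x hx => obtain ⟨e, rfl⟩ := hx; exact h e a
    | zero => simp
    | add x y _ _ hx hy => simp [hx, hy]
    | smul c x _ hx => simp [hx]
  have h3 := Submodule.finrank_mono h2
  rw [finrank_span_eq_card hw] at h3
  rw [finrank_span_eq_card hφ] at h1
  rw [Fintype.card_fin] at h3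
  omega

theorem exists_det_ne_zero_of_linearIndependent {K : Type*} [Field K] {s n : ℕ}
    (M : Matrix (Fin s) (Fin n) K) (hM : LinearIndependent K M.row) :
    ∃ c : Fin s → Fin n, (Matrix.of fun i j => M i (c j)).det ≠ 0 := by
  have hr : Module.finrank K (Submodule.span K (Set.range M.col)) = s := by
    rw [← Matrix.rank_eq_finrank_span_cols]; simpa using hM.rank_matrix
  obtain ⟨f, hf, -, hli⟩ := Submodule.exists_fun_fin_finrank_span_eq K (Set.range M.col)
  choose c hc using hf
  refine ⟨fun i => c (Fin.cast hr.symm i), ?_⟩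
  rw [← isUnit_iff_ne_zero, ← Matrix.isUnit_iff_isUnit_det,
    ← Matrix.linearIndependent_cols_iff_isUnit]
  have : (Matrix.of fun i j => M i (c (Fin.cast hr.symm j))).col = f ∘ Fin.cast hr.symm := by
    ext j i
    simp [← hc]
  rw [this]
  exact hli.comp _ (Fin.cast_injective _)

theorem natCast_le_height_vanishingIdeal_zero (n : ℕ) :
    (n : WithBot ℕ∞) ≤ (RingHom.ker (eval (0 : Fin n → ℂ))).height := by
  have h : ringKrullDim (MvPolynomial (Fin n) ℂ) = n := by simp
  rw [← h, ringKrullDim_le_iff_isMaximal_height_le]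
  intro m hm
  obtain ⟨a, rfl⟩ := isMaximal_iff_eq_vanishingIdeal_singleton.1 hm
  let τ : MvPolynomial (Fin n) ℂ ≃ₐ[ℂ] MvPolynomial (Fin n) ℂ :=
    AlgEquiv.ofAlgHom (aeval fun i => X i + C (a i)) (aeval fun i => X i - C (a i))
      (by ext; simp) (by ext; simp)
  have hτ (p : MvPolynomial (Fin n) ℂ) : eval 0 (τ p) = eval a p := by
    have : (aeval (0 : Fin n → ℂ)).comp τ.toAlgHom = aeval a := by ext; simp [τ]
    simpa [aeval_eq_eval] using DFunLike.congr_fun this p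
  have : vanishingIdeal ℂ {a} = (RingHom.ker (eval (0 : Fin n → ℂ))).comap τ.toRingEquiv := by
    ext p
    rw [mem_vanishingIdeal_singleton_iff, Ideal.mem_comap, RingHom.mem_ker]
    exact (hτ p).symm ▸ Iff.rfl
  rw [this, RingEquiv.height_comap]

theorem natCast_le_ringKrullDim_quotient_add_encard {n : ℕ} (s : Set (MvPolynomial (Fin n) ℂ))
    (hs : ∀ p ∈ s, eval 0 p = 0) :
    (n : WithBot ℕ∞) ≤ ringKrullDim (MvPolynomial (Fin n) ℂ ⧸ Ideal.span s) + s.encard := by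
  have : (RingHom.ker (eval (0 : Fin n → ℂ))).IsPrime := RingHom.ker_isPrime _
  exact (natCast_le_height_vanishingIdeal_zero n).trans
    (Ideal.height_le_ringKrullDim_quotient_add_encard s hs)

section Differential

variable {n : ℕ} {L : Type*} [Field L] [Algebra ℂ L]

/-- The differential at `x` of a complex polynomial, as a functional on tangent vectors. -/
def differentialAt (x : Fin n → L) (f : MvPolynomial (Fin n) ℂ) : Module.Dual L (Fin n → L) :=
  ∑ l, aeval x (pderiv l f) • LinearMap.proj l

theorem differentialAt_apply (x : Fin n → L) (f : MvPolynomial (Fin n) ℂ) (ξ : Fin n → L) :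
    differentialAt x f ξ = ∑ l, aeval x (pderiv l f) * ξ l := by
  simp [differentialAt]

theorem differentialAt_add (x : Fin n → L) (f g : MvPolynomial (Fin n) ℂ) :
    differentialAt x (f + g) = differentialAt x f + differentialAt x g := by
  simp [differentialAt, add_smul, Finset.sum_add_distrib]

theorem differentialAt_mul (x : Fin n → L) (f g : MvPolynomial (Fin n) ℂ) :
    differentialAt x (f * g) = aeval x f • differentialAt x g + aeval x g • differentialAt x f := by
  ext ξ
  simp only [differentialAt, Derivation.leibniz, smul_eq_mul, map_add, map_mul, add_smul,
    Finset.sum_add_distrib, Finset.smul_sum, mul_smul]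

theorem differentialAt_C (x : Fin n → L) (a : ℂ) : differentialAt x (C a) = 0 := by
  simp [differentialAt]

theorem differentialAt_X (x ξ : Fin n → L) (i : Fin n) : differentialAt x (X i) ξ = ξ i := by
  simp [differentialAt_apply, pderiv_X, Pi.single_apply, apply_ite (aeval x)]

/-- The value at `x` of the polynomial obtained from `f` by applying `D` to its coefficients. -/
def coeffDeriv (D : Derivation ℤ L L) (x : Fin n → L) (f : MvPolynomial (Fin n) ℂ) : L :=
  D (aeval x f) - differentialAt x f fun l => D (x l)

variable (D : Derivation ℤ L L) (x : Fin n → L)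

theorem coeffDeriv_add (f g : MvPolynomial (Fin n) ℂ) :
    coeffDeriv D x (f + g) = coeffDeriv D x f + coeffDeriv D x g := by
  simp only [coeffDeriv, map_add, differentialAt_add, LinearMap.add_apply]; ring

theorem coeffDeriv_mul (f g : MvPolynomial (Fin n) ℂ) :
    coeffDeriv D x (f * g) = aeval x f * coeffDeriv D x g + aeval x g * coeffDeriv D x f := by
  simp only [coeffDeriv, map_mul, Derivation.leibniz, differentialAt_mul, LinearMap.add_apply,
    LinearMap.smul_apply, smul_eq_mul]
  ring

theorem coeffDeriv_C (a : ℂ) : coeffDeriv D x (C a) = D (algebraMap ℂ L a) := by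
  simp [coeffDeriv, differentialAt_C]

theorem coeffDeriv_X (i : Fin n) : coeffDeriv D x (X i) = 0 := by
  simp [coeffDeriv, differentialAt_X]

theorem coeffDeriv_zero : coeffDeriv D x 0 = 0 := by
  simpa using coeffDeriv_C D x 0

theorem coeffDeriv_sum {ι : Type*} (s : Finset ι) (f : ι → MvPolynomial (Fin n) ℂ) :
    coeffDeriv D x (∑ i ∈ s, f i) = ∑ i ∈ s, coeffDeriv D x (f i) :=
  map_sum (⟨⟨coeffDeriv D x, coeffDeriv_zero D x⟩, coeffDeriv_add D x⟩ :
    MvPolynomial (Fin n) ℂ →+ L) f s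

theorem coeffDeriv_X_pow (i : Fin n) (m : ℕ) : coeffDeriv D x (X i ^ m) = 0 := by
  induction m with
  | zero => simpa using coeffDeriv_C D x 1
  | succ m ih => rw [pow_succ, coeffDeriv_mul, ih, coeffDeriv_X]; simp

theorem coeffDeriv_eq_zero (hD : ∀ a : ℂ, D (algebraMap ℂ L a) = 0)
    (f : MvPolynomial (Fin n) ℂ) : coeffDeriv D x f = 0 := by
  induction f using MvPolynomial.induction_on with
  | C a => rw [coeffDeriv_C, hD]
  | add p q hp hq => rw [coeffDeriv_add, hp, hq, add_zero]
  | mul_X p i hp => rw [coeffDeriv_mul, hp, coeffDeriv_X]; simp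

theorem differentialAt_apply_derivation (δ : Derivation ℂ L L) (f : MvPolynomial (Fin n) ℂ) :
    differentialAt x f (fun l => δ (x l)) = δ (aeval x f) := by
  let D : Derivation ℤ L L := δ.restrictScalars ℤ
  have h : coeffDeriv D x f = 0 := coeffDeriv_eq_zero D x (fun a => δ.map_algebraMap a) f
  exact (sub_eq_zero.1 h).symm

/-- A linear relation between the differentials at a common zero of some polynomials also holds
after differentiating the coefficients of these polynomials instead. -/
theorem sum_mul_coeffDeriv_eq_zero {ι : Type*} (s : Finset ι) (μ : ι → L)
    (f : ι → MvPolynomial (Fin n) ℂ) (hf : ∀ i ∈ s, aeval x (f i) = 0)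
    (hμ : ∑ i ∈ s, μ i • differentialAt x (f i) = 0) :
    ∑ i ∈ s, μ i * coeffDeriv D x (f i) = 0 := by
  have h := LinearMap.congr_fun hμ fun l => D (x l)
  simp only [LinearMap.sum_apply, LinearMap.smul_apply, smul_eq_mul, LinearMap.zero_apply] at h
  rw [← neg_eq_zero, ← h, ← Finset.sum_neg_distrib]
  refine Finset.sum_congr rfl fun i hi => ?_
  rw [coeffDeriv, hf i hi, map_zero]
  ring

end Differential

/-- If the points of `V(I)` with coordinates in extension fields of `ℂ` admit at most `d`
independent derivations, then `V(I)` has dimension at most `d`. -/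
theorem ringKrullDim_quotient_le_of_derivations {n d : ℕ} (I : Ideal (MvPolynomial (Fin n) ℂ))
    (h : ∀ (L : Type) [Field L] [Algebra ℂ L] (x : Fin n → L), (∀ p ∈ I, aeval x p = 0) →
      ∀ (t : ℕ) (δ : Fin t → Derivation ℂ L L),
        LinearIndependent L (fun a l => δ a (x l)) → t ≤ d) :
    ringKrullDim (MvPolynomial (Fin n) ℂ ⧸ I) ≤ d := by
  refine ringKrullDim_quotient_le_of_isPrime I _ fun P hP hIP => ?_
  let A := MvPolynomial (Fin n) ℂ ⧸ P
  let L := FractionRing A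
  obtain ⟨t, y, hy, ht⟩ := exists_algebraicIndependent_ringKrullDim_le (K := ℂ) (A := A)
  refine ht.trans ?_
  have hy' : AlgebraicIndependent ℂ (fun i => algebraMap A L (y i)) :=
    hy.map' (f := IsScalarTower.toAlgHom ℂ A L) (IsFractionRing.injective A L)
  choose δ hδ using fun a : Fin t =>
    exists_derivation_of_algebraicIndependent hy' (Pi.single a (1 : L))
  let x : Fin n → L := fun l => algebraMap A L (Ideal.Quotient.mk P (X l))
  have hx (p : MvPolynomial (Fin n) ℂ) : aeval x p = algebraMap A L (Ideal.Quotient.mk P p) := by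
    have : aeval x = (IsScalarTower.toAlgHom ℂ A L).comp (Ideal.Quotient.mkₐ ℂ P) := by
      ext l
      simp only [aeval_X, AlgHom.comp_apply]
      rfl
    rw [this]; rfl
  refine mod_cast h L x (fun p hp => ?_) t δ ?_
  · rw [hx, Ideal.Quotient.eq_zero_iff_mem.2 (hIP hp), map_zero]
  · rw [Fintype.linearIndependent_iff]
    intro c hc b
    obtain ⟨p, hp⟩ := Ideal.Quotient.mk_surjective (y b)
    let D : Derivation ℂ L L := ∑ a, c a • δ a
    have hD (u : L) : D u = ∑ a, c a * δ a u := by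
      simp only [D, ← Derivation.coeFnAddMonoidHom_apply, map_sum, Finset.sum_apply]
      rfl
    have hDx (l : Fin n) : D (x l) = 0 := by
      rw [hD]; simpa using congr_fun hc l
    have h1 : D (aeval x p) = 0 := by
      rw [← differentialAt_apply_derivation]
      simp [hDx, differentialAt_apply]
    rw [hx, hp, hD] at h1
    simpa [hδ, Pi.single_apply] using h1

theorem exists_derivation_dual {c : ℕ × ℕ × ℕ → ℂ} (hc : AlgebraicIndependent ℚ c)
    (L : Type*) [Field L] [Algebra ℂ L] (p : ℕ × ℕ × ℕ) :
    ∃ D : Derivation ℤ L L, ∀ q, D (algebraMap ℂ L (c q)) = if q = p then 1 else 0 := by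
  have : CharZero L := charZero_of_injective_algebraMap (algebraMap ℂ L).injective
  have hc' : AlgebraicIndependent ℚ (fun q => algebraMap ℂ L (c q)) :=
    hc.map' (f := (algebraMap ℂ L).toRatAlgHom) (algebraMap ℂ L).injective
  obtain ⟨D, hD⟩ := exists_derivation_of_algebraicIndependent hc' fun q => if q = p then 1 else 0
  exact ⟨D.restrictScalars ℤ, hD⟩

/-- The diagonal form of degree `w i j` with coefficients `c (i, j, l)`. -/
def diagForm (n : ℕ) (c : ℕ × ℕ × ℕ → ℂ) (w : ℕ → ℕ → ℕ) (i j : ℕ) : MvPolynomial (Fin n) ℂ :=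
  ∑ l : Fin n, C (c (i, j, l)) * X l ^ w i j

theorem diagForm_isHomogeneous (n : ℕ) (c : ℕ × ℕ × ℕ → ℂ) (w : ℕ → ℕ → ℕ) (i j : ℕ) :
    (diagForm n c w i j).IsHomogeneous (w i j) :=
  IsHomogeneous.sum _ _ _ fun l _ => by
    simpa using (isHomogeneous_C (Fin n) (c (i, j, l))).mul (isHomogeneous_X_pow l (w i j))

section Generic

variable {n : ℕ} {c : ℕ × ℕ × ℕ → ℂ} (w : ℕ → ℕ → ℕ) {L : Type*} [Field L] [Algebra ℂ L]

theorem coeffDeriv_diagForm {D : Derivation ℤ L L} (x : Fin n → L) {i' j' : ℕ} {l' : Fin n}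
    (hD : ∀ q, D (algebraMap ℂ L (c q)) = if q = (i', j', l'.val) then 1 else 0) (i j : ℕ) :
    coeffDeriv D x (diagForm n c w i j) = if i = i' ∧ j = j' then x l' ^ w i j else 0 := by
  simp only [diagForm, coeffDeriv_sum, coeffDeriv_mul, coeffDeriv_C, coeffDeriv_X_pow, hD]
  by_cases h : i = i' ∧ j = j'
  · simp [h, Fin.val_inj]
  · have (l : Fin n) : ¬ (i, j, l.val) = (i', j', l'.val) := by
      simp only [Prod.mk.injEq]; tauto
    simp [h, this]

theorem linearIndepOn_differentialAt_diagForm (hc : AlgebraicIndependent ℚ c) {x : Fin n → L}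
    (hx : x ≠ 0) (i : ℕ) (s : Finset ℕ) (hs : ∀ j ∈ s, aeval x (diagForm n c w i j) = 0) :
    LinearIndepOn L (fun j => differentialAt x (diagForm n c w i j)) s := by
  obtain ⟨l, hl⟩ := Function.ne_iff.1 hx
  rw [linearIndepOn_finset_iff]
  intro μ hμ j hj
  obtain ⟨D, hD⟩ := exists_derivation_dual hc L (i, j, l.val)
  have := sum_mul_coeffDeriv_eq_zero D x s μ _ hs hμ
  simp only [coeffDeriv_diagForm w x hD] at this
  simpa [hj, show x l ≠ 0 from hl] using this

theorem eq_zero_of_linearIndependent_zero {t : ℕ} {δ : Fin t → Derivation ℂ L L}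
    (h : LinearIndependent L (fun a (l : Fin n) => δ a ((0 : Fin n → L) l))) : t = 0 := by
  by_contra ht
  exact h.ne_zero ⟨0, Nat.pos_of_ne_zero ht⟩ (by ext; simp)

end Generic

/-- Diagonal forms up to the index `r`, followed by generic combinations of them. -/
def mixedForm (n : ℕ) (c : ℕ × ℕ × ℕ → ℂ) (w : ℕ → ℕ → ℕ) (r m i : ℕ) :
    MvPolynomial (Fin n) ℂ :=
  if i ≤ r then diagForm n c w 0 (if i < m then i else i + 1)
  else ∑ j ∈ Finset.Icc 1 (i + 2), diagForm n c w i j * diagForm n c w 0 j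

section Mixed

variable {n : ℕ} {c : ℕ × ℕ × ℕ → ℂ} {w : ℕ → ℕ → ℕ} {r m : ℕ} {L : Type*} [Field L]
  [Algebra ℂ L] {D : Derivation ℤ L L} {x : Fin n → L} {i' j' : ℕ} {l : Fin n}

theorem coeffDeriv_mixedForm_of_le
    (hD : ∀ q, D (algebraMap ℂ L (c q)) = if q = (i', j', l.val) then 1 else 0) {i : ℕ}
    (hi : i ≤ r) :
    coeffDeriv D x (mixedForm n c w r m i) =
      if 0 = i' ∧ (if i < m then i else i + 1) = j' then x l ^ w i' j' else 0 := by
  rw [mixedForm, if_pos hi, coeffDeriv_diagForm w x hD]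
  split_ifs with h <;> simp_all

theorem coeffDeriv_mixedForm_of_lt
    (hD : ∀ q, D (algebraMap ℂ L (c q)) = if q = (i', j', l.val) then 1 else 0) {i : ℕ}
    (hi : r < i) (hi' : i' ≠ 0) :
    coeffDeriv D x (mixedForm n c w r m i) =
      if i = i' ∧ j' ∈ Finset.Icc 1 (i + 2) then aeval x (diagForm n c w 0 j') * x l ^ w i' j'
      else 0 := by
  rw [mixedForm, if_neg (by omega), coeffDeriv_sum]
  simp only [coeffDeriv_mul, coeffDeriv_diagForm w x hD, hi'.symm, false_and, if_false, mul_zero,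
    zero_add]
  by_cases h : i = i'
  · simp [h]
  · simp [h]

theorem coeffDeriv_mixedForm_zero
    (hD : ∀ q, D (algebraMap ℂ L (c q)) = if q = (0, j', l.val) then 1 else 0) {i : ℕ}
    (hi : r < i) :
    coeffDeriv D x (mixedForm n c w r m i) =
      if j' ∈ Finset.Icc 1 (i + 2) then aeval x (diagForm n c w i j') * x l ^ w 0 j' else 0 := by
  rw [mixedForm, if_neg (by omega), coeffDeriv_sum]
  simp only [coeffDeriv_mul, coeffDeriv_diagForm w x hD, (Nat.zero_lt_of_lt hi).ne', false_and,
    if_false, mul_zero, add_zero, true_and]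
  simp

theorem exists_normalized_relation (hc : AlgebraicIndependent ℚ c) (hx : x ≠ 0) {s : ℕ}
    (hf : ∀ i ∈ Finset.Icc 1 s, aeval x (mixedForm n c w r m i) = 0)
    (hdep : ¬ LinearIndepOn L (fun i => differentialAt x (mixedForm n c w r m i))
      (Finset.Icc 1 s : Finset ℕ)) :
    ∃ (i₀ : ℕ) (ρ : ℕ → L), r < i₀ ∧ i₀ ≤ s ∧ ρ i₀ = 1 ∧ (∀ i, i₀ < i → i ≤ s → ρ i = 0) ∧
      ∑ i ∈ Finset.Icc 1 s, ρ i • differentialAt x (mixedForm n c w r m i) = 0 := by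
  obtain ⟨l, hl⟩ := Function.ne_iff.1 hx
  rw [linearIndepOn_finset_iff] at hdep
  push Not at hdep
  obtain ⟨μ, hμ, j, hj, hμj⟩ := hdep
  classical
  have hne : ((Finset.Ioc r s).filter fun i => μ i ≠ 0).Nonempty := by
    by_contra hempty
    have hzero (i : ℕ) (hi : r < i) (his : i ≤ s) : μ i = 0 := by
      by_contra h
      exact hempty ⟨i, by simp [*]⟩
    have hjr : j ≤ r := by
      by_contra h
      exact hμj (hzero j (by omega) (Finset.mem_Icc.1 hj).2)
    obtain ⟨D, hD⟩ := exists_derivation_dual hc L (0, if j < m then j else j + 1, l.val)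
    have h := sum_mul_coeffDeriv_eq_zero D x _ μ _ hf hμ
    rw [Finset.sum_eq_single_of_mem j hj, coeffDeriv_mixedForm_of_le hD hjr] at h
    · simp only [and_self, if_true, mul_eq_zero] at h
      exact h.elim hμj (pow_ne_zero _ hl)
    · intro i hi hij
      rcases le_or_gt i r with hir | hir
      · rw [coeffDeriv_mixedForm_of_le hD hir, if_neg, mul_zero]
        rintro ⟨-, h⟩
        split_ifs at h <;> omega
      · rw [hzero i hir (Finset.mem_Icc.1 hi).2, zero_mul]
  obtain ⟨i₀, hi₀, hmax⟩ := Finset.exists_max_image _ id hne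
  simp only [Finset.mem_filter, Finset.mem_Ioc, id] at hi₀ hmax
  refine ⟨i₀, fun i => (μ i₀)⁻¹ * μ i, hi₀.1.1, hi₀.1.2, inv_mul_cancel₀ hi₀.2,
    fun i hi his => ?_, ?_⟩
  · by_contra h
    have := hmax i ⟨⟨by omega, his⟩, right_ne_zero_of_mul h⟩
    omega
  · simp only [mul_smul, ← Finset.smul_sum, hμ, smul_zero]

theorem aeval_diagForm_eq_zero_of_relation (hc : AlgebraicIndependent ℚ c) (hx : x ≠ 0) {s : ℕ}
    (hf : ∀ i ∈ Finset.Icc 1 s, aeval x (mixedForm n c w r m i) = 0) {ρ : ℕ → L}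
    (hρ : ∑ i ∈ Finset.Icc 1 s, ρ i • differentialAt x (mixedForm n c w r m i) = 0)
    {i : ℕ} (hir : r < i) (his : i ≤ s) (hi : ρ i ≠ 0) {j : ℕ} (hj : j ∈ Finset.Icc 1 (i + 2)) :
    aeval x (diagForm n c w 0 j) = 0 := by
  obtain ⟨l, hl⟩ := Function.ne_iff.1 hx
  obtain ⟨D, hD⟩ := exists_derivation_dual hc L (i, j, l.val)
  have h := sum_mul_coeffDeriv_eq_zero D x _ ρ _ hf hρ
  rw [Finset.sum_eq_single_of_mem i (Finset.mem_Icc.2 ⟨by omega, his⟩),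
    coeffDeriv_mixedForm_of_lt hD hir (by omega), if_pos ⟨rfl, hj⟩] at h
  · simpa [hi, show x l ≠ 0 from hl] using h
  · intro i' _ hi'
    rcases le_or_gt i' r with h' | h'
    · rw [coeffDeriv_mixedForm_of_le hD h', if_neg (by omega), mul_zero]
    · rw [coeffDeriv_mixedForm_of_lt hD h' (by omega), if_neg (by tauto), mul_zero]

theorem sum_mul_aeval_diagForm_eq_zero_of_relation (hc : AlgebraicIndependent ℚ c) (hx : x ≠ 0)
    {s : ℕ} (hf : ∀ i ∈ Finset.Icc 1 s, aeval x (mixedForm n c w r m i) = 0) {ρ : ℕ → L}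
    (hρ : ∑ i ∈ Finset.Icc 1 s, ρ i • differentialAt x (mixedForm n c w r m i) = 0)
    {j : ℕ} (hj : r + 2 ≤ j) :
    ∑ i ∈ Finset.Icc 1 s, (if r < i ∧ j ≤ i + 2 then ρ i * aeval x (diagForm n c w i j) else 0)
      = 0 := by
  obtain ⟨l, hl⟩ := Function.ne_iff.1 hx
  obtain ⟨D, hD⟩ := exists_derivation_dual hc L (0, j, l.val)
  have h := sum_mul_coeffDeriv_eq_zero D x _ ρ _ hf hρ
  refine (mul_eq_zero.1 (?_ : _ * x l ^ w 0 j = 0)).resolve_right (pow_ne_zero _ hl)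
  rw [Finset.sum_mul]
  refine Eq.trans (Finset.sum_congr rfl fun i hi => ?_) h
  rcases le_or_gt i r with h' | h'
  · rw [coeffDeriv_mixedForm_of_le hD h', if_neg (by omega), if_neg (by split_ifs <;> omega)]
    simp
  · rw [coeffDeriv_mixedForm_zero hD h']
    by_cases hji : j ≤ i + 2
    · rw [if_pos ⟨h', hji⟩, if_pos (Finset.mem_Icc.2 ⟨by omega, hji⟩), mul_assoc]
    · simp [hji]

theorem add_le_of_singular (hc : AlgebraicIndependent ℚ c) (hx : x ≠ 0) {s : ℕ}
    (hf : ∀ i ∈ Finset.Icc 1 s, aeval x (mixedForm n c w r m i) = 0)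
    (hdep : ¬ LinearIndepOn L (fun i => differentialAt x (mixedForm n c w r m i))
      (Finset.Icc 1 s : Finset ℕ))
    {t : ℕ} {δ : Fin t → Derivation ℂ L L} (hδ : LinearIndependent L fun a l => δ a (x l)) :
    t + s + 4 ≤ n := by
  obtain ⟨l, hl⟩ := Function.ne_iff.1 hx
  obtain ⟨i₀, ρ, hri, his, hρi, hρz, hρ⟩ := exists_normalized_relation hc hx hf hdep
  let G (j : ℕ) := diagForm n c w 0 j
  have hG₀ (j : ℕ) (hj : j ∈ Finset.Icc 1 (i₀ + 2)) : aeval x (G j) = 0 :=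
    aeval_diagForm_eq_zero_of_relation hc hx hf hρ hri his (by simp [hρi]) hj
  obtain ⟨q, hiq, hqs, hGq, hGq'⟩ : ∃ q, i₀ + 2 ≤ q ∧ q ≤ s + 2 ∧
      (∀ j ∈ Finset.Icc 1 q, aeval x (G j) = 0) ∧ (q < s + 2 → aeval x (G (q + 1)) ≠ 0) := by
    classical
    let P (q : ℕ) : Prop := ∀ j ∈ Finset.Icc 1 q, aeval x (G j) = 0
    refine ⟨Nat.findGreatest P (s + 2), Nat.le_findGreatest (by omega) hG₀,
      Nat.findGreatest_le _, Nat.findGreatest_spec (P := P) (n := s + 2) (m := i₀ + 2) (by omega) hG₀,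
      fun h h0 => Nat.findGreatest_is_greatest (P := P) (lt_add_one _) h fun j hj => ?_⟩
    rcases (Finset.mem_Icc.1 hj).2.eq_or_lt with rfl | h'
    · exact h0
    · exact Nat.findGreatest_spec (P := P) (n := s + 2) (m := i₀ + 2) (by omega) hG₀ j
        (Finset.mem_Icc.2 ⟨(Finset.mem_Icc.1 hj).1, by omega⟩)
  let F (p : ℕ) := if p ≤ q then G p else mixedForm n c w r m (p - 2)
  have hF (p : ℕ) (hp : p ∈ Finset.Icc 1 (s + 2)) : aeval x (F p) = 0 := by
    rw [Finset.mem_Icc] at hp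
    by_cases h : p ≤ q
    · simpa [F, h] using hGq p (Finset.mem_Icc.2 ⟨hp.1, h⟩)
    · simpa [F, h] using hf (p - 2) (Finset.mem_Icc.2 ⟨by omega, by omega⟩)
  let A (j : ℕ) (ξ : ℕ → L) : L :=
    ∑ i ∈ Finset.Icc 1 s, if r < i ∧ j ≤ i + 2 then ρ i * ξ i else 0
  let φ : Finset.Icc 1 (s + 2) ⊕ Finset.Icc (r + 2) (i₀ + 2) →
      Module.Dual L ((Fin n → L) × (Finset.Ioo r i₀ → L)) :=
    Sum.elim (fun p => differentialAt x (F p) ∘ₗ LinearMap.fst L _ _) fun j =>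
      (∑ i ∈ Finset.Icc 1 s, (if r < i ∧ j.1 ≤ i + 2 then ρ i else 0) •
        differentialAt x (diagForm n c w i j)) ∘ₗ LinearMap.fst L _ _ +
      (∑ i : Finset.Ioo r i₀, (if j.1 ≤ i.1 + 2 then aeval x (diagForm n c w i j) else 0) •
        LinearMap.proj i) ∘ₗ LinearMap.snd L _ _
  let W (D : L → L) : (Fin n → L) × (Finset.Ioo r i₀ → L) :=
    (fun l => D (x l), fun i => D (ρ i))
  have hφl (D : Derivation ℤ L L) (p : Finset.Icc 1 (s + 2)) :
      φ (Sum.inl p) (W D) = - coeffDeriv D x (F p) := by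
    simp [φ, W, coeffDeriv, hF p p.2]
  have hφr (D : Derivation ℤ L L) (j : Finset.Icc (r + 2) (i₀ + 2)) :
      φ (Sum.inr j) (W D) = - A j fun i => coeffDeriv D x (diagForm n c w i j) := by
    have hD := congr_arg D (sum_mul_aeval_diagForm_eq_zero_of_relation hc hx hf hρ
      (Finset.mem_Icc.1 j.2).1)
    have hsum : ∑ i : Finset.Ioo r i₀,
        (if j.1 ≤ i.1 + 2 then aeval x (diagForm n c w i j) else 0) * D (ρ i) =
        ∑ i ∈ Finset.Icc 1 s,
          if r < i ∧ j ≤ i + 2 then aeval x (diagForm n c w i j) * D (ρ i) else 0 := by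
      rw [Finset.sum_coe_sort (Finset.Ioo r i₀) fun i =>
        (if j.1 ≤ i + 2 then aeval x (diagForm n c w i j) else 0) * D (ρ i)]
      refine Finset.sum_subset_zero_on_sdiff (fun i hi => ?_) (fun i hi => ?_) fun i hi => ?_
      · rw [Finset.mem_Ioo] at hi
        exact Finset.mem_Icc.2 ⟨by omega, by omega⟩
      · simp only [Finset.mem_sdiff, Finset.mem_Icc, Finset.mem_Ioo] at hi
        split_ifs with h
        · rcases eq_or_lt_of_le (show i₀ ≤ i by omega) with rfl | h'
          · simp [hρi]
          · simp [hρz i h' hi.1.2]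
        · rfl
      · simp [(Finset.mem_Ioo.1 hi).1]
    simp only [φ, W, Sum.elim_inr, LinearMap.add_apply, LinearMap.comp_apply, LinearMap.fst_apply,
      LinearMap.snd_apply, LinearMap.sum_apply, LinearMap.smul_apply, smul_eq_mul,
      LinearMap.proj_apply, hsum, A]
    rw [← Finset.sum_add_distrib, eq_neg_iff_add_eq_zero, ← Finset.sum_add_distrib]
    rw [map_sum, map_zero] at hD
    refine Eq.trans (Finset.sum_congr rfl fun i _ => ?_) hD
    split_ifs
    · simp only [coeffDeriv, Derivation.leibniz, smul_eq_mul]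
      ring
    · simp
  have hφ : LinearIndependent L φ := by
    rw [Fintype.linearIndependent_iff]
    intro μ hμ
    have key (D : Derivation ℤ L L) : ∑ p : Finset.Icc 1 (s + 2), μ (Sum.inl p) *
        coeffDeriv D x (F p) + ∑ j : Finset.Icc (r + 2) (i₀ + 2), μ (Sum.inr j) *
          A j (fun i => coeffDeriv D x (diagForm n c w i j)) = 0 := by
      have := LinearMap.congr_fun hμ (W D)
      simp only [Fintype.sum_sum_type, LinearMap.add_apply, LinearMap.sum_apply,
        LinearMap.smul_apply, smul_eq_mul, hφl, hφr, mul_neg, Finset.sum_neg_distrib,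
        LinearMap.zero_apply] at this
      linear_combination -this
    have hr (j) : μ (Sum.inr j) = 0 := by
      obtain ⟨D, hD⟩ := exists_derivation_dual hc L (i₀, j.1, l.val)
      have h := key D
      rw [Finset.sum_eq_zero, zero_add, Finset.sum_eq_single_of_mem j (Finset.mem_univ _)] at h
      · have hj := Finset.mem_Icc.1 j.2
        simp only [A] at h
        rw [Finset.sum_eq_single_of_mem i₀ (Finset.mem_Icc.2 ⟨by omega, his⟩)] at h
        · rw [if_pos ⟨hri, hj.2⟩, hρi, coeffDeriv_diagForm w x hD] at h
          simpa [show x l ≠ 0 from hl] using h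
        · intro i _ hi
          simp [coeffDeriv_diagForm w x hD, hi]
      · intro j' _ hj'
        simp only [A, coeffDeriv_diagForm w x hD]
        simp [hj']
      · intro p _
        by_cases h : p.1 ≤ q
        · simp [F, h, G, coeffDeriv_diagForm w x hD, show 0 ≠ i₀ by omega]
        · simp only [F, h, if_false]
          rw [coeffDeriv_mixedForm_of_lt hD (by omega) (by omega), if_neg (by omega), mul_zero]
    simp only [hr, zero_mul, Finset.sum_const_zero, add_zero] at key
    have hl₁ (p : Finset.Icc 1 (s + 2)) (hp : q < p) : μ (Sum.inl p) = 0 := by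
      have hp' := Finset.mem_Icc.1 p.2
      obtain ⟨D, hD⟩ := exists_derivation_dual hc L (p.1 - 2, q + 1, l.val)
      have h := key D
      rw [Finset.sum_eq_single_of_mem p (Finset.mem_univ _)] at h
      · simp only [F, hp.not_ge, if_false] at h
        rw [coeffDeriv_mixedForm_of_lt hD (by omega) (by omega),
          if_pos ⟨rfl, Finset.mem_Icc.2 ⟨by omega, by omega⟩⟩] at h
        have := hGq' (by omega)
        simpa [show x l ≠ 0 from hl, show aeval x (diagForm n c w 0 (q + 1)) ≠ 0 from this] using h
      · intro p' _ hne
        have hne' : p'.1 ≠ p.1 := fun h => hne (Subtype.ext h)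
        by_cases h : p'.1 ≤ q
        · simp [F, h, G, coeffDeriv_diagForm w x hD, show 0 ≠ p.1 - 2 by omega]
        · simp only [F, h, if_false]
          rw [coeffDeriv_mixedForm_of_lt hD (by omega) (by omega), if_neg (by omega), mul_zero]
    have hl₂ (p : Finset.Icc 1 (s + 2)) (hp : p.1 ≤ q) : μ (Sum.inl p) = 0 := by
      obtain ⟨D, hD⟩ := exists_derivation_dual hc L (0, p.1, l.val)
      have h := key D
      rw [Finset.sum_eq_single_of_mem p (Finset.mem_univ _)] at h
      · simpa [F, hp, G, coeffDeriv_diagForm w x hD, show x l ≠ 0 from hl] using h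
      · intro p' _ hne
        have hne' : p'.1 ≠ p.1 := fun h => hne (Subtype.ext h)
        by_cases h : p'.1 ≤ q
        · simp [F, h, G, coeffDeriv_diagForm w x hD, hne']
        · rw [hl₁ p' (by omega), zero_mul]
    rintro (p | j)
    · exact (le_or_gt p.1 q).elim (hl₂ p) (hl₁ p)
    · exact hr j
  have hW : LinearIndependent L fun a => W (δ a) :=
    LinearIndependent.of_comp (LinearMap.fst L _ _) hδ
  have hcard := card_add_card_le_finrank _ hW φ hφ fun e a => by
    let D : Derivation ℤ L L := (δ a).restrictScalars ℤ
    have hD (p : MvPolynomial (Fin n) ℂ) : coeffDeriv D x p = 0 :=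
      coeffDeriv_eq_zero D x (fun z => (δ a).map_algebraMap z) p
    change φ e (W D) = 0
    rcases e with p | j
    · rw [hφl, hD, neg_zero]
    · simp [hφr, hD, A]
  simp only [Fintype.card_sum, Fintype.card_coe, Nat.card_Icc, Module.finrank_prod,
    Module.finrank_fintype_fun_eq_card, Fintype.card_fin, Nat.card_Ioo] at hcard
  omega

end Mixed

theorem add_le_of_linearIndepOn {n : ℕ} {L : Type*} [Field L] [Algebra ℂ L] {x : Fin n → L}
    {s : ℕ} {p : ℕ → MvPolynomial (Fin n) ℂ} (hp : ∀ i ∈ Finset.Icc 1 s, aeval x (p i) = 0)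
    (hli : LinearIndepOn L (fun i => differentialAt x (p i)) (Finset.Icc 1 s : Finset ℕ))
    {t : ℕ} {δ : Fin t → Derivation ℂ L L} (hδ : LinearIndependent L fun a l => δ a (x l)) :
    t + s ≤ n := by
  have := card_add_card_le_finrank (E := Finset.Icc 1 s) _ hδ _ hli fun i a => by
    change differentialAt x (p i) (fun l => δ a (x l)) = 0
    rw [differentialAt_apply_derivation, hp i i.2, map_zero]
  simpa using this

theorem linearIndependent_row_of_linearIndepOn {n : ℕ} {L : Type*} [Field L] [Algebra ℂ L]
    {x : Fin n → L} {s : ℕ} {p : ℕ → MvPolynomial (Fin n) ℂ}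
    (hli : LinearIndepOn L (fun i => differentialAt x (p i)) (Finset.Icc 1 s : Finset ℕ)) :
    LinearIndependent L
      (Matrix.of fun (a : Fin s) l => aeval x (pderiv l (p (a.1 + 1)))).row := by
  refine LinearIndependent.of_comp (Fintype.linearCombination L
    (fun l : Fin n => (LinearMap.proj l : Module.Dual L (Fin n → L)))) ?_
  exact hli.comp (fun a : Fin s => ⟨a.1 + 1, by simp⟩) fun a b h => by
    simpa [Fin.ext_iff] using h

theorem natCast_sub_le_ringKrullDim_quotient {n : ℕ} (s : ℕ) (p : ℕ → MvPolynomial (Fin n) ℂ)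
    (hs : s ≤ n) (hp : ∀ i, 1 ≤ i → i ≤ s → eval 0 (p i) = 0) :
    ((n - s : ℕ) : WithBot ℕ∞) ≤
      ringKrullDim (MvPolynomial (Fin n) ℂ ⧸ Ideal.span (p '' Set.Icc 1 s)) := by
  have h := natCast_le_ringKrullDim_quotient_add_encard (p '' Set.Icc 1 s) (by
    rintro _ ⟨i, hi, rfl⟩
    exact hp i hi.1 hi.2)
  have hcard : (p '' Set.Icc 1 s).encard ≤ s := by
    refine (Set.encard_image_le _ _).trans ?_
    rw [← Finset.coe_Icc, Set.encard_coe_eq_coe_finsetCard]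
    simp
  generalize ringKrullDim (MvPolynomial (Fin n) ℂ ⧸ Ideal.span (p '' Set.Icc 1 s)) = v at h
  have h' : (n : WithBot ℕ∞) ≤ v + (s : ℕ∞) :=
    h.trans (add_le_add le_rfl (WithBot.coe_le_coe.2 hcard))
  induction v with
  | bot => simp at h'
  | coe v =>
    induction v with
    | top => exact WithBot.coe_le_coe.2 le_top
    | coe v =>
      norm_cast at h' ⊢
      have h' : n ≤ v + s := by exact_mod_cast h'
      have : n - s ≤ v := by omega
      exact_mod_cast this

theorem diagForm_ne_zero {n : ℕ} [NeZero n] {c : ℕ × ℕ × ℕ → ℂ} (hc : AlgebraicIndependent ℚ c)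
    (w : ℕ → ℕ → ℕ) (i j : ℕ) : diagForm n c w i j ≠ 0 := by
  intro h
  obtain ⟨D, hD⟩ := exists_derivation_dual hc ℂ (i, j, (0 : Fin n).val)
  have := coeffDeriv_diagForm w (1 : Fin n → ℂ) hD i j
  simp [h, coeffDeriv_zero] at this

theorem aeval_one_diagForm_ne_zero {n : ℕ} [NeZero n] {c : ℕ × ℕ × ℕ → ℂ}
    (hc : AlgebraicIndependent ℚ c) (w : ℕ → ℕ → ℕ) (i j : ℕ) :
    aeval (1 : Fin n → ℂ) (diagForm n c w i j) ≠ 0 := by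
  intro h
  obtain ⟨D, hD⟩ := exists_derivation_dual hc ℂ (i, j, (0 : Fin n).val)
  have := coeffDeriv_diagForm w (1 : Fin n → ℂ) hD i j
  simp [coeffDeriv, h, differentialAt_apply] at this

theorem mixedForm_ne_zero {n : ℕ} [NeZero n] {c : ℕ × ℕ × ℕ → ℂ} (hc : AlgebraicIndependent ℚ c)
    (w : ℕ → ℕ → ℕ) (r m i : ℕ) : mixedForm n c w r m i ≠ 0 := by
  rcases le_or_gt i r with hi | hi
  · rw [mixedForm, if_pos hi]
    exact diagForm_ne_zero hc w _ _
  · intro h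
    obtain ⟨D, hD⟩ := exists_derivation_dual hc ℂ (i, 1, (0 : Fin n).val)
    have := coeffDeriv_mixedForm_of_lt (w := w) (m := m) (x := (1 : Fin n → ℂ)) hD hi (by omega)
    rw [h, coeffDeriv_zero, if_pos ⟨rfl, by simp⟩] at this
    exact aeval_one_diagForm_ne_zero hc w 0 1 (by simpa using this.symm)

theorem mixedForm_isHomogeneous {n : ℕ} (c : ℕ × ℕ × ℕ → ℂ) {w : ℕ → ℕ → ℕ} {r m i δ : ℕ}
    (hle : i ≤ r → δ = w 0 (if i < m then i else i + 1))
    (hlt : r < i → ∀ j ∈ Finset.Icc 1 (i + 2), w i j + w 0 j = δ) :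
    (mixedForm n c w r m i).IsHomogeneous δ := by
  rcases le_or_gt i r with hi | hi
  · rw [mixedForm, if_pos hi, hle hi]
    exact diagForm_isHomogeneous n c w _ _
  · rw [mixedForm, if_neg hi.not_ge]
    exact IsHomogeneous.sum _ _ _ fun j hj => hlt hi j hj ▸
      (diagForm_isHomogeneous n c w i j).mul (diagForm_isHomogeneous n c w 0 j)

theorem mixedForm_mem_span (n : ℕ) (c : ℕ × ℕ × ℕ → ℂ) (w : ℕ → ℕ → ℕ) {r m i k : ℕ}
    (hi : 1 ≤ i) (hik : i + 1 ≤ k) (hik' : r < i → i + 2 ≤ k) :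
    mixedForm n c w r m i ∈ Ideal.span (diagForm n c w 0 '' Set.Icc 1 k) := by
  rcases le_or_gt i r with hir | hir
  · rw [mixedForm, if_pos hir]
    exact Ideal.subset_span ⟨_, ⟨by split_ifs <;> omega, by split_ifs <;> omega⟩, rfl⟩
  · rw [mixedForm, if_neg hir.not_ge]
    refine Ideal.sum_mem _ fun j hj => Ideal.mul_mem_left _ _ (Ideal.subset_span ⟨j, ?_, rfl⟩)
    have := hik' hir
    rw [Finset.mem_Icc] at hj
    exact ⟨hj.1, by omega⟩

theorem eval_zero_of_isHomogeneous {n a : ℕ} {p : MvPolynomial (Fin n) ℂ} (hp : p.IsHomogeneous a)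
    (ha : 1 ≤ a) : eval 0 p = 0 := by
  rw [eval_zero, constantCoeff_eq]
  exact hp.coeff_eq_zero (by simp; omega)

theorem ringKrullDim_quotient_diagForm {n : ℕ} {c : ℕ × ℕ × ℕ → ℂ}
    (hc : AlgebraicIndependent ℚ c) (w : ℕ → ℕ → ℕ) {s : ℕ} (hs : s ≤ n)
    (hw : ∀ j, 1 ≤ j → j ≤ s → 1 ≤ w 0 j) :
    ringKrullDim (MvPolynomial (Fin n) ℂ ⧸ Ideal.span (diagForm n c w 0 '' Set.Icc 1 s)) =
      ((n - s : ℕ) : WithBot ℕ∞) := by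
  refine le_antisymm (ringKrullDim_quotient_le_of_derivations _ fun L _ _ x hx t δ hδ => ?_)
    (natCast_sub_le_ringKrullDim_quotient s _ hs fun j hj hjs =>
      eval_zero_of_isHomogeneous (diagForm_isHomogeneous n c w 0 j) (hw j hj hjs))
  rcases eq_or_ne x 0 with rfl | hx0
  · rw [eq_zero_of_linearIndependent_zero hδ]
    omega
  · have hz (j) (hj : j ∈ Finset.Icc 1 s) : aeval x (diagForm n c w 0 j) = 0 :=
      hx _ (Ideal.subset_span ⟨j, Finset.mem_Icc.1 hj, rfl⟩)
    have := add_le_of_linearIndepOn hz (linearIndepOn_differentialAt_diagForm w hc hx0 0 _ hz) hδ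
    omega

theorem ringKrullDim_quotient_mixedForm {n : ℕ} {c : ℕ × ℕ × ℕ → ℂ}
    (hc : AlgebraicIndependent ℚ c) (w : ℕ → ℕ → ℕ) (r m : ℕ) {s : ℕ} (hs : s ≤ n)
    (hz : ∀ i, 1 ≤ i → i ≤ s → eval 0 (mixedForm n c w r m i) = 0) :
    ringKrullDim (MvPolynomial (Fin n) ℂ ⧸ Ideal.span (mixedForm n c w r m '' Set.Icc 1 s)) =
      ((n - s : ℕ) : WithBot ℕ∞) := by
  refine le_antisymm (ringKrullDim_quotient_le_of_derivations _ fun L _ _ x hx t δ hδ => ?_)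
    (natCast_sub_le_ringKrullDim_quotient s _ hs hz)
  rcases eq_or_ne x 0 with rfl | hx0
  · rw [eq_zero_of_linearIndependent_zero hδ]
    omega
  · have hz (j) (hj : j ∈ Finset.Icc 1 s) : aeval x (mixedForm n c w r m j) = 0 :=
      hx _ (Ideal.subset_span ⟨j, Finset.mem_Icc.1 hj, rfl⟩)
    by_cases hli : LinearIndepOn L (fun i => differentialAt x (mixedForm n c w r m i))
      (Finset.Icc 1 s : Finset ℕ)
    · have := add_le_of_linearIndepOn hz hli hδ
      omega
    · have := add_le_of_singular hc hx0 hz hli hδ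
      omega

theorem ringKrullDim_quotient_singularIdeal_mixedForm {n : ℕ} {c : ℕ × ℕ × ℕ → ℂ}
    (hc : AlgebraicIndependent ℚ c) (w : ℕ → ℕ → ℕ) (r m s : ℕ) :
    ringKrullDim (MvPolynomial (Fin (n + 1)) ℂ ⧸
      singularIdeal n s (mixedForm (n + 1) c w r m)) ≤ ((n + 1 - s - 4 : ℕ) : WithBot ℕ∞) := by
  refine ringKrullDim_quotient_le_of_derivations _ fun L _ _ x hx t δ hδ => ?_
  rcases eq_or_ne x 0 with rfl | hx0
  · rw [eq_zero_of_linearIndependent_zero hδ]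
    omega
  · have hz (j) (hj : j ∈ Finset.Icc 1 s) : aeval x (mixedForm (n + 1) c w r m j) = 0 :=
      hx _ (Ideal.subset_span (Or.inl ⟨j, Finset.mem_Icc.1 hj, rfl⟩))
    have hli : ¬ LinearIndepOn L (fun i => differentialAt x (mixedForm (n + 1) c w r m i))
        (Finset.Icc 1 s : Finset ℕ) := by
      intro h
      obtain ⟨a, ha⟩ := exists_det_ne_zero_of_linearIndependent _
        (linearIndependent_row_of_linearIndepOn h)
      refine ha ?_
      rw [← hx _ (Ideal.subset_span (Or.inr ⟨a, rfl⟩)), AlgHom.map_det]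
      rfl
    have := add_le_of_singular hc hx0 hz hli hδ
    omega

theorem rank_jacobianAt_diagForm {n : ℕ} {c : ℕ × ℕ × ℕ → ℂ}
    (hc : AlgebraicIndependent ℚ c) (w : ℕ → ℕ → ℕ) {s : ℕ} {x : Fin (n + 1) → ℂ} (hx : x ≠ 0)
    (hz : ∀ j, 1 ≤ j → j ≤ s → eval x (diagForm (n + 1) c w 0 j) = 0) :
    (jacobianAt n s (diagForm (n + 1) c w 0) x).rank = s := by
  have h := linearIndependent_row_of_linearIndepOn
    (linearIndepOn_differentialAt_diagForm w hc hx 0 (Finset.Icc 1 s) fun j hj => by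
      rw [aeval_eq_eval]
      exact hz j (Finset.mem_Icc.1 hj).1 (Finset.mem_Icc.1 hj).2)
  have := h.rank_matrix
  simpa [jacobianAt] using this

theorem stmt_14 (k : ℕ) (hk : 1 ≤ k) (d e : ℕ → ℕ)
    (hdpos : ∀ i, 1 ≤ i → i ≤ k → 1 ≤ d i)
    (hepos : ∀ j, 1 ≤ j → j ≤ k + 1 → 1 ≤ e j)
    (hdmono : ∀ i j, 1 ≤ i → i ≤ j → j ≤ k → d i ≤ d j)
    (hemono : ∀ i j, 1 ≤ i → i ≤ j → j ≤ k + 1 → e i ≤ e j)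
    (hC1 : CondOne k d e) (hC2 : CondTwo k d e) (hC3 : CondThree k d e) :
    ∃ f g : ℕ → MvPolynomial (Fin (k + 4)) ℂ,
      (∀ j, 1 ≤ j → j ≤ k + 1 → g j ≠ 0 ∧ (g j).IsHomogeneous (e j)) ∧
      (∀ i, 1 ≤ i → i ≤ k → f i ≠ 0 ∧ (f i).IsHomogeneous (d i)) ∧
      -- (a) each f_i lies in the ideal ⟨g_1,…,g_{k+1}⟩
      (∀ i, 1 ≤ i → i ≤ k → f i ∈ Ideal.span (g '' Set.Icc 1 (k + 1))) ∧
      -- (b) for i ≤ k+1, V(g_1,…,g_i) is smooth of dimension k+3−i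
      (∀ i, 1 ≤ i → i ≤ k + 1 →
        ringKrullDim (MvPolynomial (Fin (k + 4)) ℂ ⧸
            Ideal.span (g '' Set.Icc 1 i)) = ((k + 4 - i : ℕ) : WithBot ℕ∞) ∧
        ∀ x : Fin (k + 4) → ℂ, x ≠ 0 → (∀ j, 1 ≤ j → j ≤ i → eval x (g j) = 0) →
          (jacobianAt (k + 3) i g x).rank = i) ∧
      -- (c) for s ≤ k−1, V(f_1,…,f_s) has dimension k+3−s and is smooth in codimension 3
      (∀ s, 1 ≤ s → s ≤ k - 1 →
        ringKrullDim (MvPolynomial (Fin (k + 4)) ℂ ⧸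
            Ideal.span (f '' Set.Icc 1 s)) = ((k + 4 - s : ℕ) : WithBot ℕ∞) ∧
        SmoothInCodimThree (k + 3) s f) := by
  obtain ⟨c, hc⟩ := exists_algebraicIndependent_complex
  classical
  let w (i j : ℕ) : ℕ := if i = 0 then e j else d i - e j
  obtain ⟨r, hrk, ⟨m, hm, hmr, hdel⟩, hmax⟩ : ∃ r, r ≤ k - 1 ∧ DelOne d e r ∧
      ∀ i, r < i → i ≤ k - 1 → ¬ DelOne d e i :=
    ⟨Nat.findGreatest (DelOne d e) (k - 1), Nat.findGreatest_le _,
      Nat.findGreatest_spec (m := 0) (Nat.zero_le _) ⟨1, by omega, by omega, by omega⟩,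
      fun i hi hik => Nat.findGreatest_is_greatest hi hik⟩
  let G := diagForm (k + 4) c w 0
  let H := mixedForm (k + 4) c w r m
  have hH (i : ℕ) (hi : 1 ≤ i) (hik : i ≤ k - 1) : (H i).IsHomogeneous (d i) := by
    refine mixedForm_isHomogeneous c (fun hir => by simpa [w, apply_ite e] using hdel i hi hir)
      fun hri j hj => ?_
    rw [Finset.mem_Icc] at hj
    have h1 : e (i + 2) ≤ d i := by
      by_contra h
      exact hmax i hri hik (hC3 i hi hik (by omega))
    have h2 := hemono j (i + 2) hj.1 hj.2 (by omega)
    simp only [w, if_pos, if_neg (show i ≠ 0 by omega)]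
    omega
  have hHz (i : ℕ) (hi : 1 ≤ i) (hik : i ≤ k - 1) : eval 0 (H i) = 0 :=
    eval_zero_of_isHomogeneous (hH i hi hik) (hdpos i hi (by omega))
  let f (i : ℕ) : MvPolynomial (Fin (k + 4)) ℂ := if i = k then X 0 ^ (d k - e k) * G k else H i
  have hf (i : ℕ) (hi : i < k) : f i = H i := if_neg hi.ne
  have hG (j : ℕ) : (G j).IsHomogeneous (e j) := by
    simpa [w] using diagForm_isHomogeneous (k + 4) c w 0 j
  refine ⟨f, G, fun j _ _ => ⟨diagForm_ne_zero hc w 0 j, hG j⟩, fun i hi hik => ?_,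
    fun i hi hik => ?_, fun i hi hik => ⟨?_, fun x hx hz => ?_⟩, fun s hs hsk => ?_⟩
  · rcases hik.eq_or_lt with rfl | hik
    · simp only [f, if_true]
      refine ⟨mul_ne_zero (pow_ne_zero _ (X_ne_zero _)) (diagForm_ne_zero hc w 0 i), ?_⟩
      have := (isHomogeneous_X_pow (R := ℂ) (0 : Fin (i + 4)) (d i - e i)).mul (hG i)
      rwa [Nat.sub_add_cancel (hC1 i hi le_rfl)] at this
    · rw [hf i hik]
      exact ⟨mixedForm_ne_zero hc w r m i, hH i hi (by omega)⟩
  · rcases hik.eq_or_lt with rfl | hik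
    · simp only [f, if_true]
      exact Ideal.mul_mem_left _ _ (Ideal.subset_span ⟨i, ⟨hi, by omega⟩, rfl⟩)
    · rw [hf i hik]
      exact mixedForm_mem_span _ c w hi (by omega) fun _ => by omega
  · exact ringKrullDim_quotient_diagForm hc w (by omega) fun j hj hji => by
      simpa [w] using hepos j hj (by omega)
  · exact rank_jacobianAt_diagForm hc w hx hz
  · have himage : f '' Set.Icc 1 s = H '' Set.Icc 1 s :=
      Set.image_congr fun i hi => hf i (by have := hi.2; omega)
    have hsing : singularIdeal (k + 3) s f = singularIdeal (k + 3) s H := by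
      unfold singularIdeal
      rw [himage]
      have (a : Fin s) : f (a.1 + 1) = H (a.1 + 1) := hf _ (by omega)
      simp only [this]
    have hdim := ringKrullDim_quotient_mixedForm hc w r m (n := k + 4) (s := s) (by omega)
      fun i hi his => hHz i hi (by omega)
    refine ⟨by rw [himage]; exact hdim, ?_⟩
    unfold SmoothInCodimThree
    rw [hsing, himage]
    have hle := ringKrullDim_quotient_singularIdeal_mixedForm (n := k + 3) hc w r m s
    calc _ ≤ ((k + 3 + 1 - s - 4 : ℕ) : WithBot ℕ∞) + (4 : ℕ) := add_le_add hle le_rfl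
      _ = ((k + 4 - s : ℕ) : WithBot ℕ∞) := by
        rw [← Nat.cast_add]
        congr 1
        omega
      _ = _ := hdim.symm
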